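/- arXiv:2403.04139 — 2 statements merged into one kernel-verified Lean document; each statement's English description precedes it below -/
import Mathlib

section
/- Let ℒ be a set of s positive integers. If 𝒜 is an ℒ-intersecting family of subsets of {1,...,n}, then |𝒜| ≤ C(n-1,s) + C(n-1,s-1) + ... + C(n-1,0). -/
open Finset in
lemma snev_step (l : ℚ) (s : ℕ) (d : ℕ → ℚ) (t : ℕ) :
    ((t : ℚ) - l) * ∑ j ∈ range (s + 1), d j * (t.choose j : ℚ)
      = ∑ j ∈ range (s + 2), ((j : ℚ) * (if j = 0 then 0 else d (j - 1))
          + ((j : ℚ) - l) * (if j ≤ s then d j else 0)) * (t.choose j : ℚ) := by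
  have key : ∀ j : ℕ, ((t : ℚ) - l) * (t.choose j : ℚ)
      = ((j : ℚ) + 1) * (t.choose (j + 1) : ℚ) + ((j : ℚ) - l) * (t.choose j : ℚ) := by
    intro j
    have h := Nat.choose_succ_right_eq t j
    rcases le_or_gt j t with hj | hj
    · have h2 : ((t.choose (j + 1) : ℕ) : ℚ) * ((j : ℚ) + 1)
          = (t.choose j : ℚ) * ((t : ℚ) - j) := by
        have := congrArg (Nat.cast (R := ℚ)) h
        push_cast [Nat.cast_sub hj] at this
        exact this
      linear_combination -h2
    · rw [Nat.choose_eq_zero_of_lt hj, Nat.choose_eq_zero_of_lt (by omega : t < j + 1)]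
      simp
  have e1 : ∑ j ∈ range (s + 2), ((j : ℚ) * (if j = 0 then 0 else d (j - 1))) * (t.choose j : ℚ)
      = ∑ j ∈ range (s + 1), d j * (((j : ℚ) + 1) * (t.choose (j + 1) : ℚ)) := by
    rw [sum_range_succ']
    simp only [Nat.cast_zero, zero_mul, add_zero]
    refine sum_congr rfl fun j _ => ?_
    simp
    ring
  have e2 : ∑ j ∈ range (s + 2), (((j : ℚ) - l) * (if j ≤ s then d j else 0)) * (t.choose j : ℚ)
      = ∑ j ∈ range (s + 1), d j * (((j : ℚ) - l) * (t.choose j : ℚ)) := by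
    rw [sum_range_succ]
    have : ¬ (s + 1 ≤ s) := by omega
    simp only [this, if_false, mul_zero, zero_mul, add_zero]
    refine sum_congr rfl fun j hj => ?_
    have : j ≤ s := by have := mem_range.1 hj; omega
    simp only [this, if_true]
    ring
  simp only [add_mul]
  rw [sum_add_distrib, e1, e2, mul_sum, ← sum_add_distrib]
  refine sum_congr rfl fun j _ => ?_
  linear_combination d j * key j

open Finset in
lemma snev_expand (c : ℚ) (L : Finset ℕ) : ∀ s, L.card ≤ s → ∃ d : ℕ → ℚ, ∀ t : ℕ,
    ∏ l ∈ L, ((t : ℚ) + c - l) = ∑ j ∈ range (s + 1), d j * (t.choose j : ℚ) := by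
  induction L using Finset.induction_on with
  | empty =>
    intro s _
    refine ⟨fun j => if j = 0 then 1 else 0, fun t => ?_⟩
    simp
  | insert l L hl ih =>
    intro s hs
    rw [card_insert_of_notMem hl] at hs
    obtain ⟨s, rfl⟩ : ∃ r, s = r + 1 := ⟨s - 1, by omega⟩
    obtain ⟨d, hd⟩ := ih s (by omega)
    refine ⟨fun j => (j : ℚ) * (if j = 0 then 0 else d (j - 1))
          + ((j : ℚ) - ((l : ℚ) - c)) * (if j ≤ s then d j else 0), fun t => ?_⟩
    rw [prod_insert hl, hd t]
    refine Eq.trans ?_ (snev_step ((l : ℚ) - c) s d t)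
    ring

open Finset in
lemma snev_sign (L : Finset ℕ) : (∀ l ∈ L, 0 < l) → ∃ d : ℕ → ℚ,
    (∀ j ≤ L.card, 0 < (-1) ^ (L.card + j) * d j) ∧ ∀ t : ℕ,
    ∏ l ∈ L, ((t : ℚ) - l) = ∑ j ∈ range (L.card + 1), d j * (t.choose j : ℚ) := by
  induction L using Finset.induction_on_max with
  | empty =>
    intro _
    refine ⟨fun j => 1, ?_, fun t => ?_⟩ <;> simp
  | insert l L hl ih =>
    intro hpos
    have hnot : l ∉ L := fun h => lt_irrefl _ (hl l h)
    obtain ⟨d, hd0, hd⟩ := ih fun x hx => hpos x (mem_insert_of_mem hx)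
    have hcard : L.card + 1 ≤ l := by
      have hsub : insert l L ⊆ Icc 1 l := by
        intro x hx
        rw [mem_Icc]
        refine ⟨hpos x hx, ?_⟩
        rcases mem_insert.1 hx with rfl | h
        · exact le_rfl
        · exact (hl x h).le
      have := card_le_card hsub
      rw [card_insert_of_notMem hnot] at this
      simpa using this
    refine ⟨fun j => (j : ℚ) * (if j = 0 then 0 else d (j - 1))
          + ((j : ℚ) - l) * (if j ≤ L.card then d j else 0), ?_, fun t => ?_⟩
    · intro j hj
      rw [card_insert_of_notMem hnot] at hj ⊢
      have h1 : 0 ≤ (-1 : ℚ) ^ (L.card + 1 + j) * ((j : ℚ) * (if j = 0 then 0 else d (j - 1))) ∧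
          (j = L.card + 1 →
            0 < (-1 : ℚ) ^ (L.card + 1 + j) * ((j : ℚ) * (if j = 0 then 0 else d (j - 1)))) := by
        rcases j with _ | j
        · simp
        · have hp := hd0 j (by omega)
          have : (-1 : ℚ) ^ (L.card + 1 + (j + 1)) = (-1) ^ (L.card + j) := by
            rw [show L.card + 1 + (j + 1) = L.card + j + 2 by ring, pow_add]; norm_num
          have h3 : 0 < (-1 : ℚ) ^ (L.card + 1 + (j + 1)) *
              (((j + 1 : ℕ) : ℚ) * (if j + 1 = 0 then 0 else d (j + 1 - 1))) := by
            rw [this]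
            simp only [Nat.add_eq_zero_iff, one_ne_zero, and_false, if_false, Nat.add_sub_cancel]
            have h4 : (0 : ℚ) < ((j + 1 : ℕ) : ℚ) := by positivity
            have := mul_pos h4 hp
            nlinarith
          exact ⟨h3.le, fun _ => h3⟩
      have hneg : (-1 : ℚ) ^ (L.card + 1 + j) = - (-1) ^ (L.card + j) := by
        rw [show L.card + 1 + j = L.card + j + 1 by ring, pow_succ]; ring
      rw [mul_add]
      rcases Nat.lt_or_ge L.card j with h | h
      · have hn : ¬ j ≤ L.card := by omega
        rw [if_neg hn]
        simpa using h1.2 (by omega)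
      · rw [if_pos h]
        have hp := hd0 j h
        have hlj : (0 : ℚ) < (l : ℚ) - j := by
          have : (j : ℚ) < l := by exact_mod_cast (by omega : j < l)
          linarith
        have h5 : 0 < (-1 : ℚ) ^ (L.card + 1 + j) * (((j : ℚ) - l) * d j) := by
          rw [hneg]
          have := mul_pos hlj hp
          linarith
        linarith [h1.1]
    · rw [prod_insert hnot, hd t, card_insert_of_notMem hnot]
      exact snev_step (l : ℚ) L.card d t

open Finset in
/-- Evaluating a polynomial in `|C ∩ X|` through its coefficients on monomials. -/
lemma snev_eval {α : Type*} [DecidableEq α] (E : Finset α) (s : ℕ) (d : ℕ → ℚ) (C X : Finset α)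
    (hC : C ⊆ E) :
    ∑ j ∈ range (s + 1), d j * ((C ∩ X).card.choose j : ℚ)
      = ∑ I ∈ E.powerset.filter (fun I => I.card ≤ s),
          if I ⊆ X then (if I ⊆ C then d I.card else 0) else 0 := by
  have h1 : ∀ j ∈ range (s + 1), d j * ((C ∩ X).card.choose j : ℚ)
      = ∑ I ∈ (E.powerset.filter (fun I => I.card ≤ s)).filter (fun I => I.card = j),
          if I ⊆ X then (if I ⊆ C then d I.card else 0) else 0 := by
    intro j hj
    have hj' := mem_range.1 hj
    rw [← card_powersetCard, mul_comm, ← nsmul_eq_mul, ← sum_const]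
    symm
    have hsub : powersetCard j (C ∩ X) ⊆
        (E.powerset.filter (fun I => I.card ≤ s)).filter (fun I => I.card = j) := by
      intro I hI
      rw [mem_powersetCard] at hI
      simp only [mem_filter, mem_powerset]
      exact ⟨⟨(hI.1.trans inter_subset_left).trans hC, by omega⟩, hI.2⟩
    rw [← sum_subset hsub]
    · refine sum_congr rfl fun I hI => ?_
      rw [mem_powersetCard] at hI
      rw [if_pos (hI.1.trans inter_subset_right), if_pos (hI.1.trans inter_subset_left), hI.2]
    · intro I hI hn
      simp only [mem_filter, mem_powerset] at hI
      by_cases hX : I ⊆ X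
      · by_cases hC' : I ⊆ C
        · exact absurd (mem_powersetCard.2 ⟨subset_inter hC' hX, hI.2⟩) hn
        · simp [hC']
      · simp [hX]
  rw [sum_congr rfl h1]
  refine sum_fiberwise_of_maps_to (g := fun I : Finset α => I.card) ?_ _
  intro I hI
  simp only [mem_filter] at hI
  exact mem_range.2 (by omega)

open Finset in
lemma snev_card {α : Type*} [DecidableEq α] (E : Finset α) (s : ℕ) :
    (E.powerset.filter (fun I => I.card ≤ s)).card = ∑ i ∈ range (s + 1), E.card.choose i := by
  rw [card_eq_sum_card_fiberwise (f := fun I : Finset α => I.card) (t := range (s + 1))]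
  · refine sum_congr rfl fun j hj => ?_
    rw [← card_powersetCard]
    congr 1
    ext I
    have := mem_range.1 hj
    simp only [mem_filter, mem_powerset, mem_powersetCard]
    constructor
    · rintro ⟨⟨h, _⟩, h2⟩; exact ⟨h, h2⟩
    · rintro ⟨h, h2⟩; exact ⟨⟨h, by omega⟩, h2⟩
  · intro I hI
    simp only [coe_filter, Set.mem_ofPred_eq] at hI
    simp only [coe_range, Set.mem_Iio]
    omega

open Finset in
/-- If the only vector orthogonal to all coordinates is zero then the dimension bound holds. -/
lemma snev_dim {β γ : Type*} [DecidableEq β] [DecidableEq γ] (S : Finset β) (T : Finset γ)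
    (M : β → γ → ℚ)
    (h : ∀ a : β → ℚ, (∀ I ∈ T, ∑ A ∈ S, a A * M A I = 0) → ∀ A ∈ S, a A = 0) :
    S.card ≤ T.card := by
  have hli : LinearIndependent ℚ (fun (A : S) (I : T) => M A I) := by
    rw [Fintype.linearIndependent_iff]
    intro g hg A
    have := h (fun b => if hb : b ∈ S then g ⟨b, hb⟩ else 0) ?_ A A.2
    · simpa using this
    · intro I hI
      have h2 := congrFun hg ⟨I, hI⟩
      simp only [Finset.sum_apply, Pi.smul_apply, smul_eq_mul, Pi.zero_apply] at h2
      rw [← h2, ← sum_coe_sort S]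
      refine sum_congr rfl fun x _ => ?_
      simp
  have := hli.fintype_card_le_finrank
  simpa using this

open Finset in
lemma snev_main {α : Type*} [DecidableEq α] (E : Finset α) (e : α) (L : Finset ℕ)
    (hLpos : ∀ l ∈ L, 0 < l) (S : Finset (Finset α)) (hS : ∀ A ∈ S, A.erase e ⊆ E)
    (hint : ∀ A ∈ S, ∀ B ∈ S, A ≠ B → (A ∩ B).card ∈ L) :
    S.card ≤ ∑ i ∈ range (L.card + 1), E.card.choose i := by
  obtain ⟨p, hp0, hp⟩ := snev_sign L hLpos
  have hp0' : ∀ j ≤ L.card, p j ≠ 0 := by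
    intro j hj h
    have := hp0 j hj
    simp [h] at this
  have hex : ∀ (c : ℚ) (k : ℕ), ∃ d : ℕ → ℚ, ∀ t : ℕ,
      ∏ l ∈ L.filter (· < k), ((t : ℚ) + c - l)
        = ∑ j ∈ range (L.card + 1), d j * (t.choose j : ℚ) :=
    fun c k => snev_expand c _ _ (card_filter_le _ _)
  choose q hq using hex
  rw [← snev_card]
  set T := E.powerset.filter (fun I => I.card ≤ L.card) with hT
  let D : Finset α → ℕ → ℚ := fun A => if e ∈ A then q 1 A.card else p
  refine snev_dim S T (fun A I => if I ⊆ A.erase e then D A I.card else 0) ?_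
  intro a ha
  -- evaluations vanish
  have hev : ∀ X : Finset α, ∑ A ∈ S, a A *
      ∑ j ∈ range (L.card + 1), D A j * (((A.erase e) ∩ X).card.choose j : ℚ) = 0 := by
    intro X
    have : ∀ A ∈ S, a A *
      ∑ j ∈ range (L.card + 1), D A j * (((A.erase e) ∩ X).card.choose j : ℚ)
      = ∑ I ∈ T, if I ⊆ X then a A * (if I ⊆ A.erase e then D A I.card else 0) else 0 := by
      intro A hA
      rw [snev_eval E L.card (D A) (A.erase e) X (hS A hA), mul_sum]
      refine sum_congr rfl fun I _ => ?_
      split_ifs <;> simp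
    rw [sum_congr rfl this, sum_comm]
    refine sum_eq_zero fun I hI => ?_
    by_cases hX : I ⊆ X
    · simp only [hX, if_true]
      exact ha I hI
    · simp [hX]
  -- Step 1
  have step1 : ∀ k, ∀ B ∈ S, e ∈ B → B.card = k → a B = 0 := by
    intro k
    induction k using Nat.strong_induction_on with
    | _ k ih =>
      intro B hB heB hk
      have h := hev B
      rw [sum_eq_single_of_mem B hB] at h
      · have hD : D B = q 1 B.card := by simp [D, heB]
        rw [hD, ← hq] at h
        rcases mul_eq_zero.1 h with h | h
        · exact h
        · exfalso
          rw [prod_eq_zero_iff] at h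
          obtain ⟨l, hl, h⟩ := h
          have hl2 := (mem_filter.1 hl).2
          have hc : (B.erase e ∩ B).card + 1 = B.card := by
            rw [inter_eq_left.2 (erase_subset _ _), card_erase_add_one heB]
          have : (B.card : ℚ) = l := by
            rw [← hc]; push_cast; linarith
          have : B.card = l := by exact_mod_cast this
          omega
      · intro A hA hAB
        by_cases heA : e ∈ A
        · rcases lt_or_ge A.card k with hlt | hge
          · rw [ih _ hlt A hA heA rfl, zero_mul]
          · have hD : D A = q 1 A.card := by simp [D, heA]
            rw [hD, ← hq]
            have hc : (A.erase e ∩ B).card + 1 = (A ∩ B).card := by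
              rw [erase_inter, card_erase_add_one (mem_inter.2 ⟨heA, heB⟩)]
            rw [prod_eq_zero (i := (A ∩ B).card), mul_zero]
            · refine mem_filter.2 ⟨hint A hA B hB hAB, ?_⟩
              refine lt_of_le_of_ne (card_le_card inter_subset_left) fun heq => ?_
              have h1 : A ∩ B = A := eq_of_subset_of_card_le inter_subset_left heq.ge
              have h2 : A ⊆ B := inter_eq_left.1 h1
              exact hAB (eq_of_subset_of_card_le h2 (by omega))
            · rw [← hc]; push_cast; ring
        · have hD : D A = p := by simp [D, heA]
          rw [hD, ← hp, erase_eq_of_notMem heA, prod_eq_zero (i := (A ∩ B).card), mul_zero]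
          · exact hint A hA B hB hAB
          · ring
  -- Step 2
  have hw : ∀ I ∈ T, ∑ A ∈ S, (if I ⊆ A.erase e then a A else 0) = 0 := by
    intro I hI
    have h := ha I hI
    have hne : p I.card ≠ 0 := hp0' _ (mem_filter.1 hI).2
    have h2 : p I.card * ∑ A ∈ S, (if I ⊆ A.erase e then a A else 0) = 0 := by
      refine Eq.trans ?_ h
      rw [mul_sum]
      refine sum_congr rfl fun A hA => ?_
      by_cases heA : e ∈ A
      · rw [step1 _ A hA heA rfl]; simp
      · have hD : D A = p := by simp [D, heA]
        rw [hD]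
        split_ifs <;> ring
    exact (mul_eq_zero.1 h2).resolve_left hne
  have step2 : ∀ k, ∀ B ∈ S, B.card + k = S.sup card → a B = 0 := by
    intro k
    induction k using Nat.strong_induction_on with
    | _ k ih =>
      intro B hB hk
      by_cases heB : e ∈ B
      · exact step1 _ B hB heB rfl
      have hBE : B ⊆ E := by
        have := hS B hB
        rwa [erase_eq_of_notMem heB] at this
      have h : ∑ A ∈ S, a A * ∑ j ∈ range (L.card + 1),
          q 0 B.card j * ((B ∩ A.erase e).card.choose j : ℚ) = 0 := by
        have : ∀ A ∈ S, a A * ∑ j ∈ range (L.card + 1),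
            q 0 B.card j * ((B ∩ A.erase e).card.choose j : ℚ)
            = ∑ I ∈ T, (if I ⊆ B then q 0 B.card I.card else 0) *
                (if I ⊆ A.erase e then a A else 0) := by
          intro A hA
          rw [snev_eval E L.card _ B (A.erase e) hBE, mul_sum]
          refine sum_congr rfl fun I _ => ?_
          split_ifs <;> ring
        rw [sum_congr rfl this, sum_comm]
        refine sum_eq_zero fun I hI => ?_
        rw [← mul_sum, hw I hI, mul_zero]
      rw [sum_eq_single_of_mem B hB] at h
      · rw [← hq] at h
        rcases mul_eq_zero.1 h with h | h
        · exact h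
        · exfalso
          rw [prod_eq_zero_iff] at h
          obtain ⟨l, hl, h⟩ := h
          have hl2 := (mem_filter.1 hl).2
          rw [erase_eq_of_notMem heB, inter_self] at h
          have : (B.card : ℚ) = l := by linarith
          have : B.card = l := by exact_mod_cast this
          omega
      · intro A hA hAB
        by_cases heA : e ∈ A
        · rw [step1 _ A hA heA rfl, zero_mul]
        rw [erase_eq_of_notMem heA]
        by_cases hsub : B ⊆ A
        · have hlt : B.card < A.card := card_lt_card (hsub.ssubset_of_ne (Ne.symm hAB))
          have hle : A.card ≤ S.sup card := le_sup (f := card) hA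
          rw [ih (S.sup card - A.card) (by omega) A hA (by omega), zero_mul]
        · rw [← hq, prod_eq_zero (i := (B ∩ A).card), mul_zero]
          · refine mem_filter.2 ⟨hint B hB A hA (Ne.symm hAB), ?_⟩
            refine card_lt_card (inter_subset_left.ssubset_of_ne fun heq => ?_)
            exact hsub (inter_eq_left.1 heq)
          · ring
  intro B hB
  have hle : B.card ≤ S.sup card := le_sup (f := card) hB
  exact step2 (S.sup card - B.card) B hB (by omega)

theorem snevily_positive (n s : ℕ) (L : Finset ℕ) (hL : L.card = s)
    (hLpos : ∀ l ∈ L, 0 < l)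
    (𝒜 : Finset (Finset (Fin n)))
    (hintersecting : ∀ A ∈ 𝒜, ∀ B ∈ 𝒜, A ≠ B → (A ∩ B).card ∈ L) :
    𝒜.card ≤ ∑ i ∈ Finset.range (s + 1), (n - 1).choose i := by
  subst hL
  rcases n with _ | m
  · have h1 : 𝒜.card ≤ 1 := by
      rw [Finset.card_le_one]
      intro A _ B _
      exact Subsingleton.elim _ _
    refine h1.trans ?_
    rw [Finset.sum_range_succ']
    simp
  · have h := snev_main (Finset.univ.erase (0 : Fin (m + 1))) 0 L hLpos 𝒜
      (fun A _ => Finset.erase_subset_erase _ (Finset.subset_univ _)) hintersecting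
    simpa using h
end

section
/- Let 𝒱 be a Sperner family of subspaces of an n-dimensional vector space over F_q, and for 0 ≤ k ≤ n let 𝒱_k be the set of members of 𝒱 of dimension k. Then ∑_{k=0}^n |𝒱_k| / [n choose k]_q ≤ 1. -/
/-- The Gaussian (q-)binomial coefficient. -/
def gaussBinom (q n k : ℕ) : ℚ :=
  ∏ i ∈ Finset.range k, ((q : ℚ) ^ (n - i) - 1) / ((q : ℚ) ^ (k - i) - 1)

lemma gb_step (q m k : ℕ) (hk : k ≤ m) :
    gaussBinom q (m + 1) k * ((q : ℚ) ^ (m + 1 - k) - 1)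
      = ((q : ℚ) ^ (m + 1) - 1) * gaussBinom q m k := by
  unfold gaussBinom
  rw [Finset.prod_div_distrib, Finset.prod_div_distrib, div_mul_eq_mul_div, mul_div_assoc',
    ← Finset.prod_range_succ (fun i => (q : ℚ) ^ (m + 1 - i) - 1), Finset.prod_range_succ']
  congr 1
  rw [mul_comm]
  congr 1
  apply Finset.prod_congr rfl
  intro i _
  congr 2
  omega

lemma gb_pos (q n k : ℕ) (hq : 2 ≤ q) (hk : k ≤ n) : 0 < gaussBinom q n k := by
  unfold gaussBinom
  have h1 : (1 : ℚ) < q := by exact_mod_cast hq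
  apply Finset.prod_pos
  intro i hi
  have hi := Finset.mem_range.1 hi
  exact div_pos (sub_pos.2 (one_lt_pow₀ h1 (by omega))) (sub_pos.2 (one_lt_pow₀ h1 (by omega)))

lemma gb_self (q n : ℕ) (hq : 2 ≤ q) : gaussBinom q n n = 1 := by
  unfold gaussBinom
  have h1 : (1 : ℚ) < q := by exact_mod_cast hq
  apply Finset.prod_eq_one
  intro i hi
  have hi := Finset.mem_range.1 hi
  exact div_self (sub_pos.2 (one_lt_pow₀ h1 (by omega))).ne'

open Classical in
lemma card_functionals {K V : Type*} [Field K] [Fintype K] [AddCommGroup V] [Module K V]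
    [FiniteDimensional K V] [Fintype (Module.Dual K V)] (U : Submodule K V) :
    (((Finset.univ.filter fun f : Module.Dual K V => f ≠ 0).filter
      fun f => U ≤ LinearMap.ker f).card : ℚ)
      = (Fintype.card K : ℚ) ^ (Module.finrank K V - Module.finrank K U) - 1 := by
  have h1 : (Finset.univ.filter fun f : Module.Dual K V => f ≠ 0).filter
      (fun f => U ≤ LinearMap.ker f)
      = (Finset.univ.filter fun f : Module.Dual K V => f ∈ U.dualAnnihilator).erase 0 := by
    ext f
    simp [Submodule.mem_dualAnnihilator, SetLike.le_def]
  have h2 : (Finset.univ.filter fun f : Module.Dual K V => f ∈ U.dualAnnihilator).card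
      = Fintype.card K ^ (Module.finrank K V - Module.finrank K U) := by
    have := Subspace.finrank_add_finrank_dualAnnihilator_eq U
    rw [← Fintype.card_subtype]
    have h3 := Module.card_eq_pow_finrank (K := K) (V := U.dualAnnihilator)
    rw [← this, Nat.add_sub_cancel_left, ← h3]
  rw [h1, Finset.card_erase_of_mem (by simp), h2, Nat.cast_sub (Nat.one_le_pow _ _ Fintype.card_pos)]
  simp

open Classical in
lemma lym_aux (K : Type*) [Field K] [Fintype K] (n : ℕ) :
    ∀ (V : Type*) [AddCommGroup V] [Module K V] [FiniteDimensional K V]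
    (_ : Module.finrank K V = n) (S : Finset (Submodule K V))
    (_ : ∀ U ∈ S, ∀ W ∈ S, U ≠ W → ¬ U ≤ W),
    ∑ U ∈ S, (gaussBinom (Fintype.card K) n (Module.finrank K U))⁻¹ ≤ 1 := by
  have hq : 2 ≤ Fintype.card K := Fintype.one_lt_card
  induction n with
  | zero =>
    intro V _ _ _ hV S hS
    have : Subsingleton V := Module.finrank_zero_iff.1 hV
    calc _ ≤ ∑ U ∈ ({⊤} : Finset (Submodule K V)),
          (gaussBinom (Fintype.card K) 0 (Module.finrank K U))⁻¹ := by
          apply Finset.sum_le_sum_of_subset_of_nonneg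
          · intro U _
            simpa using Subsingleton.elim U ⊤
          · intro U _ _
            exact (inv_pos.2 (gb_pos _ _ _ hq (hV ▸ Submodule.finrank_le U))).le
      _ ≤ 1 := by simp [hV, gb_self _ _ hq]
  | succ m ih =>
    intro V _ _ _ hV S hS
    by_cases htop : ⊤ ∈ S
    · have : S = {⊤} := by
        ext U
        simp only [Finset.mem_singleton]
        refine ⟨fun hU => ?_, fun h => h ▸ htop⟩
        by_contra hne
        exact hS U hU ⊤ htop hne le_top
      rw [this]
      simp [hV, gb_self _ _ hq]
    · have : Finite (Module.Dual K V) := Module.finite_of_finite K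
      have : Fintype (Module.Dual K V) := Fintype.ofFinite _
      have h1 : (1 : ℚ) < Fintype.card K := by exact_mod_cast hq
      set q := Fintype.card K with hqdef
      have hpos : (0 : ℚ) < (q : ℚ) ^ (m + 1) - 1 := sub_pos.2 (one_lt_pow₀ h1 (by omega))
      set F := Finset.univ.filter fun f : Module.Dual K V => f ≠ 0 with hF
      have hFcard : (F.card : ℚ) = (q : ℚ) ^ (m + 1) - 1 := by
        have := card_functionals (⊥ : Submodule K V)
        simpa [hV] using this
      have hlt : ∀ U ∈ S, Module.finrank K U ≤ m := by
        intro U hU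
        have := Submodule.finrank_lt (s := U) (fun h => htop (h ▸ hU))
        omega
      have key : ((q : ℚ) ^ (m + 1) - 1) *
          ∑ U ∈ S, (gaussBinom q (m + 1) (Module.finrank K U))⁻¹
          = ∑ f ∈ F, ∑ U ∈ S.filter (fun U => U ≤ LinearMap.ker f),
            (gaussBinom q m (Module.finrank K U))⁻¹ := by
        simp_rw [Finset.sum_filter (p := fun U => U ≤ _)]
        rw [Finset.sum_comm, Finset.mul_sum]
        apply Finset.sum_congr rfl
        intro U hU
        rw [← Finset.sum_filter, Finset.sum_const, nsmul_eq_mul, card_functionals, hV]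
        have a := gb_step q m _ (hlt U hU)
        have b := gb_pos q m _ hq (hlt U hU)
        have c := gb_pos q (m + 1) _ hq ((hlt U hU).trans (Nat.le_succ m))
        rw [← div_eq_mul_inv, ← div_eq_mul_inv, div_eq_div_iff c.ne' b.ne', ← a, mul_comm]
      have bound : ∀ f ∈ F, ∑ U ∈ S.filter (fun U => U ≤ LinearMap.ker f),
            (gaussBinom q m (Module.finrank K U))⁻¹ ≤ 1 := by
        intro f hf
        have hf0 : f ≠ 0 := by simpa [hF] using hf
        have hk : Module.finrank K (LinearMap.ker f) = m := by
          have := Module.Dual.finrank_ker_add_one_of_ne_zero hf0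
          omega
        have hinj : ∀ U ∈ S.filter (fun U => U ≤ LinearMap.ker f),
            (U.comap (LinearMap.ker f).subtype).map (LinearMap.ker f).subtype = U := by
          intro U hU
          rw [Submodule.map_comap_subtype]
          exact inf_eq_right.2 (Finset.mem_filter.1 hU).2
        have := ih (LinearMap.ker f) hk ((S.filter (fun U => U ≤ LinearMap.ker f)).image
          (fun U => U.comap (LinearMap.ker f).subtype)) (by
            intro A hA B hB hne hle
            obtain ⟨A, hA', rfl⟩ := Finset.mem_image.1 hA
            obtain ⟨B, hB', rfl⟩ := Finset.mem_image.1 hB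
            refine hS A (Finset.mem_filter.1 hA').1 B (Finset.mem_filter.1 hB').1
              (fun h => hne (by rw [h])) ?_
            rw [← hinj A hA', ← hinj B hB']
            exact Submodule.map_mono hle)
        rw [Finset.sum_image (by
          intro A hA B hB h
          rw [← hinj A hA, ← hinj B hB]
          exact congrArg (Submodule.map (LinearMap.ker f).subtype) h)] at this
        refine le_trans (le_of_eq ?_) this
        apply Finset.sum_congr rfl
        intro U hU
        rw [LinearEquiv.finrank_eq
          (Submodule.comapSubtypeEquivOfLe (Finset.mem_filter.1 hU).2)]
      have tot := Finset.sum_le_sum bound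
      rw [← key, Finset.sum_const, nsmul_eq_mul, hFcard] at tot
      exact le_of_mul_le_mul_left tot hpos

theorem lym_subspaces (q n : ℕ) (K : Type*) [Field K] [Fintype K]
    (hq : Fintype.card K = q)
    (V : Type*) [AddCommGroup V] [Module K V] [FiniteDimensional K V]
    (hdim : Module.finrank K V = n)
    (𝒱 : Finset (Submodule K V))
    (hSperner : ∀ U ∈ 𝒱, ∀ W ∈ 𝒱, U ≠ W → ¬ U ≤ W) :
    ∑ k ∈ Finset.range (n + 1),
      ((𝒱.filter fun U : Submodule K V => Module.finrank K U = k).card : ℚ) / gaussBinom q n k ≤ 1 := by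
  subst hq
  refine le_trans (le_of_eq ?_) (lym_aux K n V hdim 𝒱 hSperner)
  rw [← Finset.sum_fiberwise_of_maps_to (s := 𝒱) (t := Finset.range (n + 1))
    (g := fun U : Submodule K V => Module.finrank K U)
    (fun U _ => Finset.mem_range.2 (Nat.lt_succ_of_le (hdim ▸ Submodule.finrank_le U)))]
  apply Finset.sum_congr rfl
  intro k _
  rw [Finset.sum_congr rfl (g := fun _ => (gaussBinom (Fintype.card K) n k)⁻¹)
    (fun U hU => by rw [(Finset.mem_filter.1 hU).2]), Finset.sum_const, nsmul_eq_mul,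
    div_eq_mul_inv]
end
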